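/- arXiv:math/0410075 — 2 statements merged into one kernel-verified Lean document; each statement's English description precedes it below -/
import Mathlib

section
/- Let A, B, C be simplicial ℚ-vector spaces with a simplicial bilinear pairing β, let p, q ≥ 1, let x ∈ A_p satisfy d_i x = 0 for all 1 ≤ i ≤ p−1, and let y ∈ B_q satisfy d_j y = 0 for all 1 ≤ j ≤ q−1. Then the shuffle pairing ⟦x,y⟧_β ∈ C_{p+q} satisfies d_k(⟦x,y⟧_β) = 0 for all 1 ≤ k ≤ p+q−1. (This is the form of the face-vanishing lemma that applies equally to simplicial graded Lie algebras and to simplicial non-associative algebras.) -/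
/-- A simplicial `ℚ`-vector space: a family of `ℚ`-vector spaces `A n` with
`ℚ`-linear face maps `d n i : A n → A (n-1)` (meaningful for `0 ≤ i ≤ n`, `n ≥ 1`)
and degeneracy maps `s n j : A n → A (n+1)` (meaningful for `0 ≤ j ≤ n`),
satisfying the simplicial identities in the valid ranges of indices. -/
structure SimplicialVecQ where
  A : ℕ → Type
  [acg : ∀ n, AddCommGroup (A n)]
  [mod : ∀ n, Module ℚ (A n)]
  d : ∀ n : ℕ, ℕ → A n →ₗ[ℚ] A (n - 1)
  s : ∀ n : ℕ, ℕ → A n →ₗ[ℚ] A (n + 1)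
  dd : ∀ (n i j : ℕ), i < j → j ≤ n + 2 → ∀ x : A (n + 2),
    d (n + 1) i (d (n + 2) j x) = d (n + 1) (j - 1) (d (n + 2) i x)
  ss : ∀ (n i j : ℕ), i ≤ j → j ≤ n → ∀ x : A n,
    s (n + 1) i (s n j x) = s (n + 1) (j + 1) (s n i x)
  ds_lt : ∀ (n i j : ℕ), i < j → j ≤ n + 1 → ∀ x : A (n + 1),
    d (n + 2) i (s (n + 1) j x) = s n (j - 1) (d (n + 1) i x)
  ds_eq : ∀ (n j : ℕ), j ≤ n → ∀ x : A n, d (n + 1) j (s n j x) = x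
  ds_eq' : ∀ (n j : ℕ), j ≤ n → ∀ x : A n, d (n + 1) (j + 1) (s n j x) = x
  ds_gt : ∀ (n i j : ℕ), j + 1 < i → i ≤ n + 2 → ∀ x : A (n + 1),
    d (n + 2) i (s (n + 1) j x) = s n j (d (n + 1) (i - 1) x)

attribute [instance] SimplicialVecQ.acg SimplicialVecQ.mod

namespace SimplicialVecQ

/-- Iterated degeneracies: `iterS n k f x = s (f (k-1)) (⋯ (s (f 1) (s (f 0) x)))`,
i.e. `s (f 0)` is applied first (innermost). -/
def iterS (X : SimplicialVecQ) (n : ℕ) : (k : ℕ) → (Fin k → ℕ) → X.A n → X.A (n + k)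
  | 0, _, x => x
  | k + 1, f, x => X.s (n + k) (f (Fin.last k)) (X.iterS n k (fun i => f i.castSucc) x)

end SimplicialVecQ

/-- For a subset `σ = {σ_1 < … < σ_p}` of `{0,…,m-1}` (with `p = σ.card`), the
exponent `ε(σ) = p + ∑_{i=1}^p (σ_i - i)`, computed in `ℤ`; here
`∑_{i=1}^p σ_i = ∑_{a ∈ σ} a` and `∑_{i=1}^p i = ∑_{i ∈ range p} (i+1)`. -/
def shuffleSign {m : ℕ} (σ : Finset (Fin m)) : ℤ :=
  (σ.card : ℤ) + ((∑ a ∈ σ, ((a : ℕ) : ℤ)) - ∑ i ∈ Finset.range σ.card, ((i : ℤ) + 1))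

lemma card_compl_shuffle {p q : ℕ} (σ : Finset (Fin (p + q))) (h : σ.card = p) :
    σᶜ.card = q := by
  have hc := Finset.card_compl σ
  rw [h, Fintype.card_fin] at hc
  omega

/-- A simplicial bilinear pairing `β : A × B → C` between simplicial `ℚ`-vector
spaces: a family of `ℚ`-bilinear maps `β n : A n × B n → C n` commuting with all
faces and degeneracies (in the valid ranges of indices). -/
structure SimplicialPairingQ (X Y Z : SimplicialVecQ) where
  β : ∀ n : ℕ, X.A n →ₗ[ℚ] Y.A n →ₗ[ℚ] Z.A n
  compat_d : ∀ (n i : ℕ), i ≤ n + 1 → ∀ (a : X.A (n + 1)) (b : Y.A (n + 1)),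
    Z.d (n + 1) i (β (n + 1) a b) = β n (X.d (n + 1) i a) (Y.d (n + 1) i b)
  compat_s : ∀ (n j : ℕ), j ≤ n → ∀ (a : X.A n) (b : Y.A n),
    Z.s n j (β n a b) = β (n + 1) (X.s n j a) (Y.s n j b)

/-- The shuffle pairing
`⟦x,y⟧_β = ∑_{(σ,τ) ∈ S_{p,q}} (-1)^{ε(σ)} β(s_{τ_q} ⋯ s_{τ_1} x, s_{σ_p} ⋯ s_{σ_1} y)`. -/
noncomputable def shufflePairing {X Y Z : SimplicialVecQ} (B : SimplicialPairingQ X Y Z)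
    {p q : ℕ} (x : X.A p) (y : Y.A q) : Z.A (p + q) :=
  ∑ σ : Finset (Fin (p + q)),
    if h : σ.card = p then
      ((-1 : ℚ) ^ shuffleSign σ) •
        B.β (p + q)
          (X.iterS p q (fun j => ((σᶜ.orderEmbOfFin (card_compl_shuffle σ h)) j : ℕ)) x)
          (cast (congrArg Y.A (Nat.add_comm q p))
            (Y.iterS q p (fun i => ((σ.orderEmbOfFin h) i : ℕ)) y))
    else 0

namespace SimplicialVecQ

variable (X : SimplicialVecQ)

lemma d_s_eq_zero_of_lt {m i j : ℕ} (hij : i < j) (hj : j ≤ m) {x : X.A m}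
    (hx : X.d m i x = 0) : X.d (m + 1) i (X.s m j x) = 0 := by
  cases m with
  | zero => omega
  | succ m => rw [X.ds_lt m i j hij hj, hx, map_zero]

lemma d_s_eq_zero_of_gt {m i j : ℕ} (hij : j + 1 < i) (hi : i ≤ m + 1) {x : X.A m}
    (hx : X.d m (i - 1) x = 0) : X.d (m + 1) i (X.s m j x) = 0 := by
  cases m with
  | zero => omega
  | succ m => rw [X.ds_gt m i j hij hi, hx, map_zero]

lemma d_cast {m n : ℕ} (e : m = n) (i : ℕ) (x : X.A m) :
    X.d n i (cast (congrArg X.A e) x) =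
      cast (congrArg (fun l => X.A (l - 1)) e) (X.d m i x) := by
  subst e
  rfl

lemma d_cast_eq_zero {m n : ℕ} (e : m = n) {i : ℕ} {x : X.A m} (hx : X.d m i x = 0) :
    X.d n i (cast (congrArg X.A e) x) = 0 := by
  subst e
  exact hx

/-- If all inner faces of `x` vanish, then so do the inner faces `d_i` of an iterated degeneracy of
`x` in which neither `s_{i-1}` nor `s_i` occurs. -/
lemma d_iterS_eq_zero {n : ℕ} {x : X.A n}
    (hx : ∀ i : ℕ, 1 ≤ i → i ≤ n - 1 → X.d n i x = 0) {k : ℕ} {f : Fin k → ℕ}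
    (hf : StrictMono f) (hfb : ∀ i, f i < n + k) {i : ℕ} (hi : 1 ≤ i) (hik : i ≤ n + k - 1)
    (h : ∀ j, f j ≠ i) (h' : ∀ j, f j ≠ i - 1) : X.d (n + k) i (X.iterS n k f x) = 0 := by
  induction k generalizing i with
  | zero => exact hx i hi hik
  | succ k ih =>
    have hlt : ∀ j : Fin k, f j.castSucc < f (Fin.last k) := fun j => hf (Fin.castSucc_lt_last j)
    have hlast := hfb (Fin.last k)
    have hne := h (Fin.last k)
    have hne' := h' (Fin.last k)
    have hmono : StrictMono fun j : Fin k => f j.castSucc :=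
      hf.comp Fin.strictMono_castSucc
    have hb : ∀ j : Fin k, f j.castSucc < n + k := fun j => by have := hlt j; omega
    rcases lt_or_ge i (f (Fin.last k)) with hlt' | hge
    · exact X.d_s_eq_zero_of_lt (m := n + k) hlt' (by omega)
        (ih hmono hb hi (by omega) (fun j => h _) (fun j => h' _))
    · exact X.d_s_eq_zero_of_gt (m := n + k) (by omega) (by omega)
        (ih hmono hb (by omega) (by omega) (fun j => by have := hlt j; omega)
          (fun j => by have := hlt j; omega))

/-- The face `d_{i+1}` does not distinguish two iterated degeneracies that differ only in that `s_i`
is replaced by `s_{i+1}`. -/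
lemma d_iterS_congr {n : ℕ} (x : X.A n) {k : ℕ} {f g : Fin k → ℕ} (hg : StrictMono g)
    (hgb : ∀ i, g i < n + k) {i : ℕ} {j₀ : Fin k} (hf₀ : f j₀ = i) (hg₀ : g j₀ = i + 1)
    (hfg : ∀ j, j ≠ j₀ → f j = g j) :
    X.d (n + k) (i + 1) (X.iterS n k f x) = X.d (n + k) (i + 1) (X.iterS n k g x) := by
  induction k with
  | zero => exact j₀.elim0
  | succ k ih =>
    have hlast := hgb (Fin.last k)
    simp only [iterS]
    rcases Fin.eq_castSucc_or_eq_last j₀ with ⟨j₁, rfl⟩ | rfl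
    · have hlt : ∀ j : Fin k, g j.castSucc < g (Fin.last k) :=
        fun j => hg (Fin.castSucc_lt_last j)
      have hj₁ := hlt j₁
      have key := ih (f := fun j => f j.castSucc) (g := fun j => g j.castSucc) (j₀ := j₁)
        (hg.comp Fin.strictMono_castSucc)
        (fun j => by have := hlt j; omega) hf₀ hg₀
        (fun j hj => hfg _ (by simpa using hj))
      rw [hfg _ (Fin.castSucc_lt_last j₁).ne']
      rw [← sub_eq_zero, ← map_sub] at key ⊢
      rw [← map_sub]
      exact X.d_s_eq_zero_of_lt (m := n + k) (by omega) (by omega) key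
    · have hinner : (fun j : Fin k => f j.castSucc) = fun j => g j.castSucc :=
        funext fun j => hfg _ (Fin.castSucc_lt_last j).ne
      rw [hf₀, hg₀, hinner]
      exact (X.ds_eq' (n + k) i (by omega) _).trans (X.ds_eq (n + k) (i + 1) (by omega) _).symm

end SimplicialVecQ

lemma SimplicialPairingQ.d_β {X Y Z : SimplicialVecQ} (B : SimplicialPairingQ X Y Z) {n i : ℕ}
    (hn : 1 ≤ n) (hi : i ≤ n) (a : X.A n) (b : Y.A n) :
    Z.d n i (B.β n a b) = B.β (n - 1) (X.d n i a) (Y.d n i b) := by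
  cases n with
  | zero => omega
  | succ n => exact B.compat_d n i hi a b

section AdjacentSwap

variable {m : ℕ} {a b : Fin m}

lemma swap_lt_swap_of_notMem (hab : (b : ℕ) = a + 1) {σ : Finset (Fin m)} (hb : b ∉ σ)
    {u v : Fin m} (hu : u ∈ σ) (hv : v ∈ σ) (huv : u < v) :
    Equiv.swap a b u < Equiv.swap a b v := by
  have hub : u ≠ b := fun h => hb (h ▸ hu)
  have hvb : v ≠ b := fun h => hb (h ▸ hv)
  simp only [Equiv.swap_apply_def, if_neg hub, if_neg hvb]
  split_ifs <;> simp only [Fin.lt_def, ne_eq, Fin.ext_iff] at * <;> omega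

/-- Replacing `a` by its successor `b` in a finset replaces `a` by `b` in its sorted enumeration. -/
lemma orderEmbOfFin_map_swap (hab : (b : ℕ) = a + 1) {σ : Finset (Fin m)} (hb : b ∉ σ) {p : ℕ}
    (h : σ.card = p) (h' : (σ.map (Equiv.swap a b).toEmbedding).card = p) (i : Fin p) :
    (σ.map (Equiv.swap a b).toEmbedding).orderEmbOfFin h' i =
      Equiv.swap a b (σ.orderEmbOfFin h i) := by
  have := Finset.orderEmbOfFin_unique h' (f := fun i => Equiv.swap a b (σ.orderEmbOfFin h i))
    (fun i => Finset.mem_map_of_mem _ (σ.orderEmbOfFin_mem h i))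
    (fun i j hij => swap_lt_swap_of_notMem hab hb (σ.orderEmbOfFin_mem h i)
      (σ.orderEmbOfFin_mem h j) ((σ.orderEmbOfFin h).strictMono hij))
  exact (congrFun this i).symm

lemma shuffleSign_map_swap (hab : (b : ℕ) = a + 1) {σ : Finset (Fin m)} (ha : a ∈ σ)
    (hb : b ∉ σ) :
    shuffleSign (σ.map (Equiv.swap a b).toEmbedding) = shuffleSign σ + 1 := by
  have hsum : ∑ u ∈ σ, ((Equiv.swap a b u : ℕ) : ℤ) = ∑ u ∈ σ, ((u : ℕ) : ℤ) + 1 := by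
    have : ∀ u ∈ σ, ((Equiv.swap a b u : ℕ) : ℤ) = ((u : ℕ) : ℤ) + if u = a then 1 else 0 := by
      intro u hu
      have hub : u ≠ b := fun h => hb (h ▸ hu)
      by_cases hua : u = a
      · subst hua
        simp [hab]
      · simp [Equiv.swap_apply_of_ne_of_ne hua hub, hua]
    rw [Finset.sum_congr rfl this, Finset.sum_add_distrib, Finset.sum_ite_eq' σ a, if_pos ha]
  simp only [shuffleSign, Finset.card_map, Finset.sum_map, Equiv.coe_toEmbedding, hsum]
  ring

lemma map_swap_map_swap (σ : Finset (Fin m)) :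
    (σ.map (Equiv.swap a b).toEmbedding).map (Equiv.swap a b).toEmbedding = σ := by
  ext u
  simp [Finset.mem_map_equiv]

lemma map_swap_eq_self {σ : Finset (Fin m)} (h : a ∈ σ ↔ b ∈ σ) :
    σ.map (Equiv.swap a b).toEmbedding = σ := by
  ext u
  rw [Finset.mem_map_equiv, Equiv.symm_swap, Equiv.swap_apply_def]
  split_ifs with h₁ h₂ <;> simp_all

lemma compl_map_swap (σ : Finset (Fin m)) :
    (σ.map (Equiv.swap a b).toEmbedding)ᶜ = σᶜ.map (Equiv.swap a b).toEmbedding := by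
  ext u
  simp [Finset.mem_map_equiv]

lemma left_mem_map_swap {σ : Finset (Fin m)} :
    a ∈ σ.map (Equiv.swap a b).toEmbedding ↔ b ∈ σ := by
  simp [Finset.mem_map_equiv]

lemma right_mem_map_swap {σ : Finset (Fin m)} :
    b ∈ σ.map (Equiv.swap a b).toEmbedding ↔ a ∈ σ := by
  simp [Finset.mem_map_equiv]

end AdjacentSwap

namespace SimplicialVecQ

variable (X : SimplicialVecQ)

/-- The degeneracy of `x` along the increasing enumeration of a finset of indices. -/
def degen {m n k : ℕ} (σ : Finset (Fin m)) (h : σ.card = k) (x : X.A n) : X.A (n + k) :=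
  X.iterS n k (fun i => (σ.orderEmbOfFin h i : ℕ)) x

lemma d_degen_eq_zero {m n k : ℕ} (hm : m = n + k) {x : X.A n}
    (hx : ∀ i : ℕ, 1 ≤ i → i ≤ n - 1 → X.d n i x = 0) {σ : Finset (Fin m)} (h : σ.card = k)
    {a b : Fin m} (hab : (b : ℕ) = a + 1) (ha : a ∉ σ) (hb : b ∉ σ) :
    X.d (n + k) b (X.degen σ h x) = 0 := by
  refine X.d_iterS_eq_zero hx (fun i j hij => (σ.orderEmbOfFin h).strictMono hij)
    (fun i => hm ▸ (σ.orderEmbOfFin h i).isLt) (by omega) (by omega) (fun j hj => hb ?_)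
    (fun j hj => ha ?_)
  · rw [← (Fin.ext hj : σ.orderEmbOfFin h j = b)]
    exact σ.orderEmbOfFin_mem h j
  · rw [← (Fin.ext (by omega) : σ.orderEmbOfFin h j = a)]
    exact σ.orderEmbOfFin_mem h j

lemma d_degen_map_swap {m n k : ℕ} (hm : m = n + k) (x : X.A n) {σ : Finset (Fin m)}
    (h : σ.card = k) {a b : Fin m} (hab : (b : ℕ) = a + 1) (ha : a ∈ σ) (hb : b ∉ σ)
    (h' : (σ.map (Equiv.swap a b).toEmbedding).card = k) :
    X.d (n + k) b (X.degen (σ.map (Equiv.swap a b).toEmbedding) h' x) =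
      X.d (n + k) b (X.degen σ h x) := by
  obtain ⟨j₀, hj₀⟩ : a ∈ Set.range (σ.orderEmbOfFin h) := by
    rw [Finset.range_orderEmbOfFin]
    exact ha
  rw [hab]
  refine (X.d_iterS_congr x (f := fun i => (σ.orderEmbOfFin h i : ℕ))
    (g := fun i => ((σ.map (Equiv.swap a b).toEmbedding).orderEmbOfFin h' i : ℕ)) (j₀ := j₀)
    (fun i j hij => (Finset.orderEmbOfFin _ h').strictMono hij)
    (fun i => (Fin.isLt _).trans_eq hm) (congrArg Fin.val hj₀) ?_ fun j hj => ?_).symm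
  · rw [orderEmbOfFin_map_swap hab hb h h', hj₀, Equiv.swap_apply_left, hab]
  · rw [orderEmbOfFin_map_swap hab hb h h', Equiv.swap_apply_of_ne_of_ne]
    · rw [← hj₀]
      exact fun e => hj ((σ.orderEmbOfFin h).injective e)
    · exact fun e => hb (e ▸ σ.orderEmbOfFin_mem h j)

end SimplicialVecQ

section ShuffleTerm

variable {X Y Z : SimplicialVecQ} (B : SimplicialPairingQ X Y Z) {p q : ℕ}

/-- The summand of the shuffle pairing indexed by `σ`. -/
noncomputable def shuffleTerm (x : X.A p) (y : Y.A q) (σ : Finset (Fin (p + q))) : Z.A (p + q) :=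
  if h : σ.card = p then
    ((-1 : ℚ) ^ shuffleSign σ) •
      B.β (p + q) (X.degen σᶜ (card_compl_shuffle σ h) x)
        (cast (congrArg Y.A (Nat.add_comm q p)) (Y.degen σ h y))
  else 0

lemma shufflePairing_eq_sum (x : X.A p) (y : Y.A q) :
    shufflePairing B x y = ∑ σ, shuffleTerm B x y σ := rfl

lemma d_shuffleTerm_eq_zero {x : X.A p} {y : Y.A q}
    (hx : ∀ i : ℕ, 1 ≤ i → i ≤ p - 1 → X.d p i x = 0)
    (hy : ∀ j : ℕ, 1 ≤ j → j ≤ q - 1 → Y.d q j y = 0) {σ : Finset (Fin (p + q))}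
    {a b : Fin (p + q)} (hab : (b : ℕ) = a + 1) (h : a ∈ σ ↔ b ∈ σ) :
    Z.d (p + q) b (shuffleTerm B x y σ) = 0 := by
  unfold shuffleTerm
  split_ifs with hσ
  · rw [map_smul, B.d_β (by omega) (by omega)]
    by_cases ha : a ∈ σ
    · rw [X.d_degen_eq_zero rfl hx _ hab (by simpa using ha) (by simpa using h.1 ha)]
      simp
    · rw [Y.d_cast_eq_zero (Nat.add_comm q p) (Y.d_degen_eq_zero (Nat.add_comm p q) hy hσ hab ha
        (fun hb => ha (h.2 hb)))]
      simp
  · exact map_zero _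

lemma d_shuffleTerm_map_swap (x : X.A p) (y : Y.A q) {σ : Finset (Fin (p + q))}
    {a b : Fin (p + q)} (hab : (b : ℕ) = a + 1) (ha : a ∈ σ) (hb : b ∉ σ) :
    Z.d (p + q) b (shuffleTerm B x y (σ.map (Equiv.swap a b).toEmbedding)) =
      -Z.d (p + q) b (shuffleTerm B x y σ) := by
  unfold shuffleTerm
  by_cases hσ : σ.card = p
  · have hσ' : (σ.map (Equiv.swap a b).toEmbedding).card = p := by rw [Finset.card_map, hσ]
    have hX : X.d (p + q) b (X.degen (σ.map (Equiv.swap a b).toEmbedding)ᶜ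
        (card_compl_shuffle _ hσ') x) =
        X.d (p + q) b (X.degen σᶜ (card_compl_shuffle σ hσ) x) := by
      have key := X.d_degen_map_swap rfl x (card_compl_shuffle _ hσ') hab
        (by simpa [left_mem_map_swap] using hb) (by simpa [right_mem_map_swap] using ha)
        (by rw [Finset.card_map, card_compl_shuffle _ hσ'])
      rw [← key]
      congr! 2
      rw [← compl_map_swap, map_swap_map_swap]
    rw [dif_pos hσ, dif_pos hσ', map_smul, map_smul, B.d_β (by omega) (by omega),
      B.d_β (by omega) (by omega), hX, Y.d_cast (Nat.add_comm q p),
      Y.d_cast (Nat.add_comm q p),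
      Y.d_degen_map_swap (Nat.add_comm p q) y hσ hab ha hb hσ', shuffleSign_map_swap hab ha hb,
      zpow_add_one₀ (by norm_num), mul_neg_one, neg_smul]
  · rw [dif_neg hσ, dif_neg (by rwa [Finset.card_map])]
    simp

end ShuffleTerm

/-- Let `A, B, C` be simplicial `ℚ`-vector spaces with a
simplicial bilinear pairing `β`, let `p, q ≥ 1`, let `x ∈ A_p` satisfy
`d_i x = 0` for all `1 ≤ i ≤ p-1`, and let `y ∈ B_q` satisfy `d_j y = 0` for all
`1 ≤ j ≤ q-1`.  Then the shuffle pairing `⟦x,y⟧_β ∈ C_{p+q}` satisfies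
`d_k ⟦x,y⟧_β = 0` for all `1 ≤ k ≤ p+q-1`. -/
theorem shufflePairing_face_vanish {X Y Z : SimplicialVecQ} (B : SimplicialPairingQ X Y Z)
    (p q : ℕ) (hp : 1 ≤ p) (hq : 1 ≤ q) (x : X.A p) (y : Y.A q)
    (hx : ∀ i : ℕ, 1 ≤ i → i ≤ p - 1 → X.d p i x = 0)
    (hy : ∀ j : ℕ, 1 ≤ j → j ≤ q - 1 → Y.d q j y = 0) :
    ∀ k : ℕ, 1 ≤ k → k ≤ p + q - 1 → Z.d (p + q) k (shufflePairing B x y) = 0 := by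
  intro k hk hk'
  obtain ⟨a, b, hab, hbk⟩ : ∃ a b : Fin (p + q), (b : ℕ) = a + 1 ∧ (b : ℕ) = k :=
    ⟨⟨k - 1, by omega⟩, ⟨k, by omega⟩, by simp only; omega, rfl⟩
  rw [← hbk, shufflePairing_eq_sum, map_sum]
  refine Finset.sum_involution (fun σ _ => σ.map (Equiv.swap a b).toEmbedding) ?_ ?_
    (fun _ _ => Finset.mem_univ _) (fun σ _ => map_swap_map_swap σ)
  · intro σ _
    by_cases h : a ∈ σ ↔ b ∈ σ
    · rw [map_swap_eq_self h, d_shuffleTerm_eq_zero B hx hy hab h, add_zero]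
    · by_cases ha : a ∈ σ
      · rw [d_shuffleTerm_map_swap B x y hab ha (by tauto), add_neg_cancel]
      · have key := d_shuffleTerm_map_swap B x y hab
          (σ := σ.map (Equiv.swap a b).toEmbedding) (left_mem_map_swap.2 (by tauto))
          (by rwa [right_mem_map_swap])
        rw [map_swap_map_swap] at key
        rw [key, neg_add_cancel]
  · intro σ _ hne heq
    refine hne (d_shuffleTerm_eq_zero B hx hy hab ?_)
    conv_lhs => rw [← heq]
    exact left_mem_map_swap
end

section
/- Let A be a simplicial Lie algebra over ℚ, let p, q ≥ 1, let x ∈ A_p satisfy d_i x = 0 for all 1 ≤ i ≤ p, and let y ∈ A_q satisfy d_j y = 0 for all 1 ≤ j ≤ q. Then d_k(⟦x,y⟧) = 0 for all 1 ≤ k ≤ p+q. In other words, the shuffle bracket restricts to a bilinear map C_p × C_q → C_{p+q} on the Moore chains C_n := ⋂_{i=1}^n Ker(d_i : A_n → A_{n−1}). -/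
/-- A simplicial Lie algebra over `ℚ`: a family of `ℚ`-Lie algebras `A n` with
face maps `d n i : A n → A (n-1)` (meaningful for `0 ≤ i ≤ n`, `n ≥ 1`) and
degeneracy maps `s n j : A n → A (n+1)` (meaningful for `0 ≤ j ≤ n`), which are
Lie algebra homomorphisms satisfying the simplicial identities in the valid
ranges of indices. -/
structure SimplicialLieQ where
  A : ℕ → Type
  [lieRing : ∀ n, LieRing (A n)]
  [lieAlgebra : ∀ n, LieAlgebra ℚ (A n)]
  d : ∀ n : ℕ, ℕ → A n →ₗ⁅ℚ⁆ A (n - 1)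
  s : ∀ n : ℕ, ℕ → A n →ₗ⁅ℚ⁆ A (n + 1)
  dd : ∀ (n i j : ℕ), i < j → j ≤ n + 2 → ∀ x : A (n + 2),
    d (n + 1) i (d (n + 2) j x) = d (n + 1) (j - 1) (d (n + 2) i x)
  ss : ∀ (n i j : ℕ), i ≤ j → j ≤ n → ∀ x : A n,
    s (n + 1) i (s n j x) = s (n + 1) (j + 1) (s n i x)
  ds_lt : ∀ (n i j : ℕ), i < j → j ≤ n + 1 → ∀ x : A (n + 1),
    d (n + 2) i (s (n + 1) j x) = s n (j - 1) (d (n + 1) i x)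
  ds_eq : ∀ (n j : ℕ), j ≤ n → ∀ x : A n, d (n + 1) j (s n j x) = x
  ds_eq' : ∀ (n j : ℕ), j ≤ n → ∀ x : A n, d (n + 1) (j + 1) (s n j x) = x
  ds_gt : ∀ (n i j : ℕ), j + 1 < i → i ≤ n + 2 → ∀ x : A (n + 1),
    d (n + 2) i (s (n + 1) j x) = s n j (d (n + 1) (i - 1) x)

attribute [instance] SimplicialLieQ.lieRing SimplicialLieQ.lieAlgebra

namespace SimplicialLieQ

/-- Iterated degeneracies: `iterS n k f x = s (f (k-1)) (⋯ (s (f 1) (s (f 0) x)))`,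
i.e. `s (f 0)` is applied first (innermost). -/
def iterS (X : SimplicialLieQ) (n : ℕ) : (k : ℕ) → (Fin k → ℕ) → X.A n → X.A (n + k)
  | 0, _, x => x
  | k + 1, f, x => X.s (n + k) (f (Fin.last k)) (X.iterS n k (fun i => f i.castSucc) x)

end SimplicialLieQ

namespace SimplicialLieQ

/-- The summand of the shuffle bracket corresponding to a `(p,q)`-shuffle `(σ, τ)`
(with `τ = σᶜ`): `[s_{τ_q} ⋯ s_{τ_1} x, s_{σ_p} ⋯ s_{σ_1} y]`. -/
noncomputable def shuffleTerm (X : SimplicialLieQ) {p q : ℕ} (x : X.A p) (y : X.A q)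
    (σ : Finset (Fin (p + q))) (h : σ.card = p) : X.A (p + q) :=
  ⁅X.iterS p q (fun j => ((σᶜ.orderEmbOfFin (card_compl_shuffle σ h)) j : ℕ)) x,
   cast (congrArg X.A (Nat.add_comm q p))
     (X.iterS q p (fun i => ((σ.orderEmbOfFin h) i : ℕ)) y)⁆

/-- The shuffle bracket
`⟦x,y⟧ = ∑_{(σ,τ) ∈ S_{p,q}} (-1)^{ε(σ)} [s_{τ_q} ⋯ s_{τ_1} x, s_{σ_p} ⋯ s_{σ_1} y]`. -/
noncomputable def shuffleBracket (X : SimplicialLieQ) {p q : ℕ}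
    (x : X.A p) (y : X.A q) : X.A (p + q) :=
  ∑ σ : Finset (Fin (p + q)),
    if h : σ.card = p then ((-1 : ℚ) ^ shuffleSign σ) • X.shuffleTerm x y σ h else 0

end SimplicialLieQ

namespace SimplicialLieQ

variable (X : SimplicialLieQ)

lemma d_s_eq_zero_of_lt {n i j : ℕ} (hn : 1 ≤ n) (hij : i < j) (hj : j ≤ n) {x : X.A n}
    (h : X.d n i x = 0) : X.d (n + 1) i (X.s n j x) = 0 := by
  obtain _ | n := n
  · omega
  · have := X.ds_lt n i j hij hj x
    rw [h, map_zero] at this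
    exact this

lemma d_s_eq_zero_of_gt {n i j : ℕ} (hn : 1 ≤ n) (hij : j + 1 < i) (hi : i ≤ n + 1) {x : X.A n}
    (h : X.d n (i - 1) x = 0) : X.d (n + 1) i (X.s n j x) = 0 := by
  obtain _ | n := n
  · omega
  · have := X.ds_gt n i j hij hi x
    rw [h, map_zero] at this
    exact this

lemma d_s_congr_of_lt {n i j : ℕ} (hij : i < j) (hj : j ≤ n) {x y : X.A n}
    (h : X.d n i x = X.d n i y) : X.d (n + 1) i (X.s n j x) = X.d (n + 1) i (X.s n j y) := by
  rw [← sub_eq_zero, ← map_sub, ← map_sub]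
  exact X.d_s_eq_zero_of_lt (by omega) hij hj (by rw [map_sub, h, sub_self])

lemma d_cast_congr {m n : ℕ} (e : m = n) (k : ℕ) {x y : X.A m} (h : X.d m k x = X.d m k y) :
    X.d n k (cast (congrArg X.A e) x) = X.d n k (cast (congrArg X.A e) y) := by
  subst e
  exact h

lemma d_cast_eq_zero {m n : ℕ} (e : m = n) (k : ℕ) {x : X.A m} (h : X.d m k x = 0) :
    X.d n k (cast (congrArg X.A e) x) = 0 := by
  subst e
  exact h

/-- A face of an iterated degeneracy of a Moore chain vanishes if it cancels none of the
degeneracies. -/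
lemma d_iterS_eq_zero {n : ℕ} (hn : 1 ≤ n) {x : X.A n}
    (hx : ∀ i : ℕ, 1 ≤ i → i ≤ n → X.d n i x = 0) (k : ℕ) (f : Fin k → ℕ) (hf : StrictMono f)
    (hlt : ∀ j, f j < n + k) (c : ℕ) (hc : 1 ≤ c) (hck : c ≤ n + k) (h₁ : ∀ j, f j ≠ c)
    (h₂ : ∀ j, f j + 1 ≠ c) : X.d (n + k) c (X.iterS n k f x) = 0 := by
  induction k generalizing c with
  | zero => exact hx c hc hck
  | succ k ih =>
    have hl := hlt (Fin.last k)
    have hl₁ := h₁ (Fin.last k)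
    have hl₂ := h₂ (Fin.last k)
    have hm : ∀ j : Fin k, f j.castSucc < f (Fin.last k) := fun j => hf (Fin.castSucc_lt_last j)
    have ih' := ih (fun i => f i.castSucc) (fun i j hij => hf (Fin.castSucc_lt_castSucc_iff.2 hij))
      (fun j => by have := hm j; omega)
    rcases lt_or_gt_of_ne hl₁ with h | h
    · exact X.d_s_eq_zero_of_gt (n := n + k) (by omega) (by omega) hck (ih' (c - 1) (by omega) (by omega)
        (fun j => by have := hm j; omega) (fun j => by have := hm j; omega))
    · exact X.d_s_eq_zero_of_lt (n := n + k) (by omega) h (by omega) (ih' c hc (by omega)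
        (fun j => h₁ _) (fun j => h₂ _))

/-- The `c`-th face does not distinguish the `c`-th and the `(c - 1)`-st degeneracy. -/
lemma d_iterS_swap {n : ℕ} (x : X.A n) (k : ℕ) (f g : Fin k → ℕ) (hf : StrictMono f)
    (hg : StrictMono g) (hflt : ∀ j, f j < n + k) (hglt : ∀ j, g j < n + k) (a : ℕ)
    (hfg : ∀ j, g j = Equiv.swap a (a + 1) (f j)) :
    X.d (n + k) (a + 1) (X.iterS n k f x) = X.d (n + k) (a + 1) (X.iterS n k g x) := by
  induction k with
  | zero => rfl
  | succ k ih =>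
    have hfl := hflt (Fin.last k)
    have hgl := hglt (Fin.last k)
    have hfm : ∀ j : Fin k, f j.castSucc < f (Fin.last k) := fun j => hf (Fin.castSucc_lt_last j)
    have hgm : ∀ j : Fin k, g j.castSucc < g (Fin.last k) := fun j => hg (Fin.castSucc_lt_last j)
    have hfg' : ∀ j, g j = if f j = a then a + 1 else if f j = a + 1 then a else f j :=
      fun j => by rw [hfg, Equiv.swap_apply_def]
    have hl := hfg' (Fin.last k)
    have heq (h : f (Fin.last k) ≤ a + 1) :
        (fun j : Fin k => f j.castSucc) = fun j : Fin k => g j.castSucc := by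
      funext j
      have h₁ := hfm j
      have h₂ := hgm j
      have h₃ := hfg' j.castSucc
      split_ifs at hl h₃ <;> omega
    have hd (t : ℕ) (ht : t = a ∨ t = a + 1) (ht' : t ≤ n + k) (z : X.A (n + k)) :
        X.d (n + k + 1) (a + 1) (X.s (n + k) t z) = z := by
      rcases ht with rfl | rfl
      · exact X.ds_eq' _ _ ht' z
      · exact X.ds_eq _ _ ht' z
    change X.d (n + k + 1) (a + 1) (X.s (n + k) (f (Fin.last k)) (X.iterS n k _ x)) =
      X.d (n + k + 1) (a + 1) (X.s (n + k) (g (Fin.last k)) (X.iterS n k _ x))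
    rcases lt_or_ge (a + 1) (f (Fin.last k)) with h | h
    · have hgf : g (Fin.last k) = f (Fin.last k) := by split_ifs at hl <;> omega
      rw [hgf]
      exact X.d_s_congr_of_lt (n := n + k) h (by omega) (ih (fun i => f i.castSucc) (fun i => g i.castSucc)
        (fun i j hij => hf (Fin.castSucc_lt_castSucc_iff.2 hij))
        (fun i j hij => hg (Fin.castSucc_lt_castSucc_iff.2 hij))
        (fun j => by have := hfm j; omega) (fun j => by have := hgm j; omega) (fun j => hfg _))
    · rw [heq h]
      rcases lt_or_ge (f (Fin.last k)) a with h' | h'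
      · rw [show g (Fin.last k) = f (Fin.last k) by split_ifs at hl <;> omega]
      · rw [hd _ (by omega) (by omega), hd _ (by split_ifs at hl <;> omega) (by omega)]

end SimplicialLieQ

lemma orderEmbOfFin_swap {m r a : ℕ} (ha : a + 1 < m) {s t : Finset (Fin m)} (hs : s.card = r)
    (ht : t.card = r) (hst : s.map (Equiv.swap ⟨a, by omega⟩ ⟨a + 1, ha⟩).toEmbedding = t)
    (hab : ¬ (⟨a, by omega⟩ ∈ s ∧ ⟨a + 1, ha⟩ ∈ s)) (j : Fin r) :
    (t.orderEmbOfFin ht j : ℕ) = Equiv.swap a (a + 1) (s.orderEmbOfFin hs j : ℕ) := by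
  have hval (x : Fin m) : ((Equiv.swap ⟨a, by omega⟩ ⟨a + 1, ha⟩ x : Fin m) : ℕ) =
      Equiv.swap a (a + 1) (x : ℕ) := by
    simp only [Equiv.swap_apply_def, Fin.ext_iff]
    split_ifs <;> rfl
  have hmono : StrictMono fun j =>
      Equiv.swap (⟨a, by omega⟩ : Fin m) ⟨a + 1, ha⟩ (s.orderEmbOfFin hs j) := by
    intro i j hij
    have h₁ : (s.orderEmbOfFin hs i : ℕ) < s.orderEmbOfFin hs j :=
      (s.orderEmbOfFin hs).strictMono hij
    have h₂ : ¬ ((s.orderEmbOfFin hs i : ℕ) = a ∧ (s.orderEmbOfFin hs j : ℕ) = a + 1) := by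
      rintro ⟨h, h'⟩
      refine hab ⟨?_, ?_⟩
      · rw [← (Fin.ext h : s.orderEmbOfFin hs i = ⟨a, by omega⟩)]
        exact s.orderEmbOfFin_mem hs i
      · rw [← (Fin.ext h' : s.orderEmbOfFin hs j = ⟨a + 1, ha⟩)]
        exact s.orderEmbOfFin_mem hs j
    rw [Fin.lt_def, hval, hval, Equiv.swap_apply_def, Equiv.swap_apply_def]
    split_ifs <;> omega
  rw [← hval, ← Finset.orderEmbOfFin_unique ht (fun j => ?_) hmono]
  rw [← hst]
  exact Finset.mem_map_of_mem _ (s.orderEmbOfFin_mem hs j)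

lemma neg_one_zpow_shuffleSign_swap {m a : ℕ} (ha : a + 1 < m) (s : Finset (Fin m))
    (hab : (⟨a, by omega⟩ ∈ s) ↔ (⟨a + 1, ha⟩ ∉ s)) :
    (-1 : ℚ) ^ shuffleSign (s.map (Equiv.swap ⟨a, by omega⟩ ⟨a + 1, ha⟩).toEmbedding) =
      - (-1 : ℚ) ^ shuffleSign s := by
  have hsum : ∑ x ∈ s.map (Equiv.swap ⟨a, by omega⟩ ⟨a + 1, ha⟩).toEmbedding, ((x : ℕ) : ℤ) =
      ∑ x ∈ s, ((x : ℕ) : ℤ) + ((if ⟨a, by omega⟩ ∈ s then 1 else 0) -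
        (if ⟨a + 1, ha⟩ ∈ s then 1 else 0)) := by
    rw [Finset.sum_map, ← Finset.sum_ite_eq' s ⟨a, by omega⟩ (fun _ => (1 : ℤ)),
      ← Finset.sum_ite_eq' s ⟨a + 1, ha⟩ (fun _ => (1 : ℤ)), ← Finset.sum_sub_distrib,
      ← Finset.sum_add_distrib]
    refine Finset.sum_congr rfl fun x _ => ?_
    simp only [Equiv.coe_toEmbedding, Equiv.swap_apply_def, Fin.ext_iff]
    split_ifs <;> simp_all
  have hne : (-1 : ℚ) ≠ 0 := by norm_num
  by_cases h : (⟨a, by omega⟩ : Fin m) ∈ s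
  · have : shuffleSign (s.map (Equiv.swap ⟨a, by omega⟩ ⟨a + 1, ha⟩).toEmbedding) =
        shuffleSign s + 1 := by
      rw [shuffleSign, shuffleSign, hsum, Finset.card_map, if_pos h, if_neg (hab.1 h)]
      ring
    rw [this, zpow_add_one₀ hne, mul_neg_one]
  · have h' : (⟨a + 1, ha⟩ : Fin m) ∈ s := by tauto
    have : shuffleSign (s.map (Equiv.swap ⟨a, by omega⟩ ⟨a + 1, ha⟩).toEmbedding) =
        shuffleSign s - 1 := by
      rw [shuffleSign, shuffleSign, hsum, Finset.card_map, if_neg h, if_pos h']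
      ring
    rw [this, zpow_sub_one₀ hne]
    norm_num

namespace SimplicialLieQ

variable (X : SimplicialLieQ) {p q : ℕ}

lemma d_iterS_orderEmbOfFin_eq_zero {n r m : ℕ} (hm : m = n + r) (hn : 1 ≤ n) {x : X.A n}
    (hx : ∀ i : ℕ, 1 ≤ i → i ≤ n → X.d n i x = 0) (s : Finset (Fin m)) (h : s.card = r)
    (k : ℕ) (hk : 1 ≤ k) (hkm : k ≤ n + r) (hs : ∀ a ∈ s, (a : ℕ) ≠ k ∧ (a : ℕ) + 1 ≠ k) :
    X.d (n + r) k (X.iterS n r (fun j => (s.orderEmbOfFin h j : ℕ)) x) = 0 :=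
  X.d_iterS_eq_zero hn hx r _ (fun _ _ hij => (s.orderEmbOfFin h).strictMono hij)
    (fun j => hm ▸ (s.orderEmbOfFin h j).isLt) k hk hkm
    (fun j => (hs _ (s.orderEmbOfFin_mem h j)).1) (fun j => (hs _ (s.orderEmbOfFin_mem h j)).2)

lemma d_iterS_orderEmbOfFin_swap {n r m a : ℕ} (hm : m = n + r) (x : X.A n) (ha : a + 1 < m)
    {s t : Finset (Fin m)} (hs : s.card = r) (ht : t.card = r)
    (hst : s.map (Equiv.swap ⟨a, by omega⟩ ⟨a + 1, ha⟩).toEmbedding = t)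
    (hab : ¬ (⟨a, by omega⟩ ∈ s ∧ ⟨a + 1, ha⟩ ∈ s)) :
    X.d (n + r) (a + 1) (X.iterS n r (fun j => (s.orderEmbOfFin hs j : ℕ)) x) =
      X.d (n + r) (a + 1) (X.iterS n r (fun j => (t.orderEmbOfFin ht j : ℕ)) x) :=
  X.d_iterS_swap x r _ _ (fun _ _ hij => (s.orderEmbOfFin hs).strictMono hij)
    (fun _ _ hij => (t.orderEmbOfFin ht).strictMono hij)
    (fun j => hm ▸ (s.orderEmbOfFin hs j).isLt) (fun j => hm ▸ (t.orderEmbOfFin ht j).isLt) a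
    (orderEmbOfFin_swap ha hs ht hst hab)

lemma d_shuffleTerm_eq_zero_of_subset (hp : 1 ≤ p) {x : X.A p} (y : X.A q)
    (hx : ∀ i : ℕ, 1 ≤ i → i ≤ p → X.d p i x = 0) (σ : Finset (Fin (p + q))) (h : σ.card = p)
    (k : ℕ) (hk : 1 ≤ k) (hkm : k ≤ p + q)
    (hσ : ∀ a : Fin (p + q), (a : ℕ) = k ∨ (a : ℕ) + 1 = k → a ∈ σ) :
    X.d (p + q) k (X.shuffleTerm x y σ h) = 0 := by
  rw [shuffleTerm, LieHom.map_lie, X.d_iterS_orderEmbOfFin_eq_zero rfl hp hx _ _ k hk hkm,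
    zero_lie]
  intro a ha
  have := mt (hσ a) (Finset.mem_compl.1 ha)
  tauto

lemma d_shuffleTerm_eq_zero_of_disjoint (hq : 1 ≤ q) (x : X.A p) {y : X.A q}
    (hy : ∀ j : ℕ, 1 ≤ j → j ≤ q → X.d q j y = 0) (σ : Finset (Fin (p + q))) (h : σ.card = p)
    (k : ℕ) (hk : 1 ≤ k) (hkm : k ≤ p + q)
    (hσ : ∀ a ∈ σ, (a : ℕ) ≠ k ∧ (a : ℕ) + 1 ≠ k) :
    X.d (p + q) k (X.shuffleTerm x y σ h) = 0 := by
  rw [shuffleTerm, LieHom.map_lie, X.d_cast_eq_zero (Nat.add_comm q p) k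
    (X.d_iterS_orderEmbOfFin_eq_zero (Nat.add_comm p q) hq hy σ h k hk (by omega) hσ), lie_zero]

lemma d_shuffleTerm_swap (x : X.A p) (y : X.A q) {a : ℕ} (ha : a + 1 < p + q)
    (σ : Finset (Fin (p + q))) (h : σ.card = p)
    (h' : (σ.map (Equiv.swap ⟨a, by omega⟩ ⟨a + 1, ha⟩).toEmbedding).card = p)
    (hab : (⟨a, by omega⟩ ∈ σ) ↔ (⟨a + 1, ha⟩ ∉ σ)) :
    X.d (p + q) (a + 1) (X.shuffleTerm x y _ h') = X.d (p + q) (a + 1) (X.shuffleTerm x y σ h) := by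
  have hc : σᶜ.map (Equiv.swap ⟨a, by omega⟩ ⟨a + 1, ha⟩).toEmbedding =
      (σ.map (Equiv.swap ⟨a, by omega⟩ ⟨a + 1, ha⟩).toEmbedding)ᶜ := by
    ext b
    simp [Finset.mem_map_equiv]
  rw [shuffleTerm, shuffleTerm, LieHom.map_lie, LieHom.map_lie]
  congr 1
  · exact (X.d_iterS_orderEmbOfFin_swap rfl x ha (card_compl_shuffle σ h)
      (card_compl_shuffle _ h') hc (by simp only [Finset.mem_compl]; tauto)).symm
  · exact X.d_cast_congr (Nat.add_comm q p) _
      (X.d_iterS_orderEmbOfFin_swap (Nat.add_comm p q) y ha h h' rfl (by tauto)).symm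

end SimplicialLieQ

/-- Let `A` be a simplicial Lie algebra over `ℚ`, let `p, q ≥ 1`,
let `x ∈ A_p` satisfy `d_i x = 0` for all `1 ≤ i ≤ p` (i.e. `x` is a Moore chain),
and let `y ∈ A_q` satisfy `d_j y = 0` for all `1 ≤ j ≤ q`. Then
`d_k ⟦x,y⟧ = 0` for all `1 ≤ k ≤ p+q`; in other words, the shuffle bracket
restricts to a bilinear map `C_p × C_q → C_{p+q}` on Moore chains
`C_n = ⋂_{i=1}^n Ker (d_i : A_n → A_{n-1})`. -/
theorem shuffleBracket_moore (X : SimplicialLieQ) (p q : ℕ) (hp : 1 ≤ p) (hq : 1 ≤ q)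
    (x : X.A p) (y : X.A q)
    (hx : ∀ i : ℕ, 1 ≤ i → i ≤ p → X.d p i x = 0)
    (hy : ∀ j : ℕ, 1 ≤ j → j ≤ q → X.d q j y = 0) :
    ∀ k : ℕ, 1 ≤ k → k ≤ p + q → X.d (p + q) k (X.shuffleBracket x y) = 0 := by
  intro k hk hkm
  obtain ⟨a, rfl⟩ : ∃ a, k = a + 1 := ⟨k - 1, by omega⟩
  have hterm (σ : Finset (Fin (p + q))) :
      X.d (p + q) (a + 1)
        (if h : σ.card = p then ((-1 : ℚ) ^ shuffleSign σ) • X.shuffleTerm x y σ h else 0) =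
      if h : σ.card = p then
        ((-1 : ℚ) ^ shuffleSign σ) • X.d (p + q) (a + 1) (X.shuffleTerm x y σ h) else 0 := by
    split_ifs
    · rw [map_smul]
    · rw [map_zero]
  rw [SimplicialLieQ.shuffleBracket, map_sum, Finset.sum_congr rfl fun σ _ => hterm σ]
  rcases hkm.eq_or_lt with hlast | ha
  · refine Finset.sum_eq_zero fun σ _ => ?_
    split_ifs with h
    · by_cases hmem : (⟨a, by omega⟩ : Fin (p + q)) ∈ σ
      · rw [X.d_shuffleTerm_eq_zero_of_subset hp y hx σ h _ hk hkm, smul_zero]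
        intro b hb
        rwa [show b = ⟨a, by omega⟩ from Fin.ext (by have := b.isLt; dsimp only; omega)]
      · rw [X.d_shuffleTerm_eq_zero_of_disjoint hq x hy σ h _ hk hkm, smul_zero]
        refine fun b hb => ⟨by have := b.isLt; omega, fun hba => hmem ?_⟩
        rwa [← show b = ⟨a, by omega⟩ from Fin.ext (by dsimp only; omega)]
    · rfl
  · have hzero (σ : Finset (Fin (p + q)))
        (hab : ¬ ((⟨a, by omega⟩ ∈ σ) ↔ (⟨a + 1, ha⟩ ∉ σ))) (h : σ.card = p) :
        X.d (p + q) (a + 1) (X.shuffleTerm x y σ h) = 0 := by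
      have hval (b : Fin (p + q)) (hb : (b : ℕ) = a + 1 ∨ (b : ℕ) + 1 = a + 1) :
          b = ⟨a + 1, ha⟩ ∨ b = ⟨a, by omega⟩ := by
        simpa [Fin.ext_iff] using hb
      by_cases hmem : (⟨a, by omega⟩ : Fin (p + q)) ∈ σ
      · refine X.d_shuffleTerm_eq_zero_of_subset hp y hx σ h _ hk hkm fun b hb => ?_
        rcases hval b hb with rfl | rfl <;> tauto
      · refine X.d_shuffleTerm_eq_zero_of_disjoint hq x hy σ h _ hk hkm fun b hb => ?_
        by_contra hcon
        rcases hval b (by tauto) with rfl | rfl <;> tauto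
    refine Finset.sum_involution
      (fun σ _ => σ.map (Equiv.swap ⟨a, by omega⟩ ⟨a + 1, ha⟩).toEmbedding) ?_ ?_
      (fun _ _ => Finset.mem_univ _) ?_
    · intro σ _
      by_cases h : σ.card = p
      · have h' : (σ.map (Equiv.swap (⟨a, by omega⟩ : Fin (p + q))
            ⟨a + 1, ha⟩).toEmbedding).card = p := by rw [Finset.card_map, h]
        rw [dif_pos h, dif_pos h']
        by_cases hab : (⟨a, by omega⟩ ∈ σ) ↔ (⟨a + 1, ha⟩ ∉ σ)
        · rw [X.d_shuffleTerm_swap x y ha σ h h' hab, neg_one_zpow_shuffleSign_swap ha σ hab,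
            neg_smul, add_neg_cancel]
        · rw [hzero σ hab h, hzero _ _ h', smul_zero, smul_zero, add_zero]
          simp only [Finset.mem_map_equiv, Equiv.symm_swap, Equiv.swap_apply_left,
            Equiv.swap_apply_right]
          tauto
      · rw [dif_neg h, dif_neg (by rwa [Finset.card_map]), add_zero]
    · intro σ _ hne heq
      refine hne ?_
      split_ifs with h
      · rw [hzero σ _ h, smul_zero]
        have : (⟨a, by omega⟩ : Fin (p + q)) ∈ σ ↔ ⟨a + 1, ha⟩ ∈ σ := by
          simpa [Finset.mem_map_equiv] using (Finset.ext_iff.1 heq ⟨a + 1, ha⟩)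
        tauto
      · rfl
    · intro σ _
      ext b
      simp [Finset.mem_map_equiv]
end
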